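/- Let Õ_1, Õ_2, … be a sequence where Õ_k is a k-partially reflective k-partial oracle and Õ_{k+1} extends Õ_k for all k ∈ ℕ, and let O := lim_{k→∞} Õ_k be the pointwise limit (which exists). Then λ_T^{Õ_k}(1|x) → λ_T^O(1|x) and λ_T^{Õ_k}(0|x) → λ_T^O(0|x) as k → ∞, for all x ∈ {0,1}* and all T ∈ 𝒯. -/

import Mathlib

namespace GrainOfTruth

open scoped Classical

/-- A probabilistic oracle Turing machine is given by a code of a partial
recursive function describing its finite-step behavior: on (input, bits received so far)
it either outputs a bit, flips a fair coin, or queries the oracle. -/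
abbrev Machine := Nat.Partrec.Code

/-- A query to the oracle: a machine `T`, an input `x`, and a rational `p`. -/
abbrev Query := Machine × List Bool × ℚ

/-- An oracle probabilistically answers each query with `0` or `1`; we represent it by
the probability of answering `1`. -/
def IsOracle (O : Query → ℝ) : Prop := ∀ q, 0 ≤ O q ∧ O q ≤ 1

instance : Denumerable (List Bool) := Denumerable.ofEncodableOfInfinite _

/-- The action a machine performs at a given configuration. -/
inductive Action : Type
  | output : Bool → Action
  | flip : Action
  | ask : Query → Action

/-- Decoding a natural number as an action. -/
def decodeAction : ℕ → Action
  | 0 => .output false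
  | 1 => .output true
  | 2 => .flip
  | (n + 3) => .ask (Denumerable.ofNat Query n)

/-- The action performed by machine `T` on input `x` after having received the
bits `s` (fair coin flips and oracle answers) so far. -/
def act (T : Machine) (x s : List Bool) : Part Action :=
  (T.eval (Nat.pair (Encodable.encode x) (Encodable.encode s))).map decodeAction

/-- Probability that the next received bit is `b`, given the current action. -/
noncomputable def bitProb (O : Query → ℝ) : Action → Bool → ℝ
  | .output _, _ => 0
  | .flip, _ => 1 / 2
  | .ask q, b => if b then O q else 1 - O q

/-- Probability that, running `T` with oracle `O` on input `x`, having already received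
the bits `pre`, the machine receives exactly the further bits `s`. -/
noncomputable def traceWeightAux (T : Machine) (O : Query → ℝ) (x : List Bool) :
    List Bool → List Bool → ℝ
  | _pre, [] => 1
  | pre, b :: rest =>
      (if h : (act T x pre).Dom then bitProb O ((act T x pre).get h) b else 0) *
        traceWeightAux T O x (pre ++ [b]) rest

/-- `lam T O x b` is the probability λ_T^O(b|x) that machine `T`, run with oracle `O`
on input `x`, outputs the bit `b`. -/
noncomputable def lam (T : Machine) (O : Query → ℝ) (x : List Bool) (b : Bool) : ℝ :=
  ∑' s : { s : List Bool // act T x s = Part.some (Action.output b) },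
    traceWeightAux T O x [] s.1

/-- An oracle `O` is reflective iff for every query `(T, x, p)`:
if λ_T^O(1|x) > p then `O` answers `1` with probability one, and
if λ_T^O(0|x) > 1 - p then `O` answers `0` with probability one. -/
def Reflective (O : Query → ℝ) : Prop :=
  IsOracle O ∧
    ∀ (T : Machine) (x : List Bool) (p : ℚ),
      ((p : ℝ) < lam T O x true → O (T, x, p) = 1) ∧
      (1 - (p : ℝ) < lam T O x false → O (T, x, p) = 0)

/-- The fixed computable enumeration of the query set: `qEnum k` is the `k`-th query
(queries indexed from `0`). -/
def qEnum : ℕ → Query := Denumerable.ofNat Query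

/-- A `k`-partial oracle is a function from the first `k` queries to the multiples of
`2^(-k)` in `[0,1]`. -/
def PartialOracle (k : ℕ) : Type :=
  { f : Fin k → ℚ // ∀ i, ∃ n : ℕ, n ≤ 2 ^ k ∧ f i = (n : ℚ) / 2 ^ k }

/-- The action performed by machine `T`, run for at most `k` steps, on input `x` after
having received the bits `s` so far (`none` if the step bound is exceeded). -/
def actn (k : ℕ) (T : Machine) (x s : List Bool) : Option Action :=
  (Nat.Partrec.Code.evaln k T (Nat.pair (Encodable.encode x) (Encodable.encode s))).map
    decodeAction

/-- Probability of the next received bit when running with a `k`-partial oracle: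
a fair coin flip answers normally; a query `q_i` with `i < k` is answered `1` with
probability `Õ(q_i) - 2^(-k-1)` and `0` with probability `1 - Õ(q_i) - 2^(-k-1)`
(otherwise the run halts); a query of index `≥ k` halts the run. -/
noncomputable def bitProbP (k : ℕ) (Ot : PartialOracle k) : Action → Bool → ℝ
  | .output _, _ => 0
  | .flip, _ => 1 / 2
  | .ask q, b =>
      if h : Encodable.encode q < k then
        if b then (Ot.1 ⟨Encodable.encode q, h⟩ : ℝ) - (2 : ℝ) ^ (-(k : ℤ) - 1)
        else 1 - (Ot.1 ⟨Encodable.encode q, h⟩ : ℝ) - (2 : ℝ) ^ (-(k : ℤ) - 1)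
      else 0

/-- Trace weights for machine `T` run with the `k`-partial oracle `Õ`. -/
noncomputable def traceWeightPAux (k : ℕ) (Ot : PartialOracle k) (T : Machine)
    (x : List Bool) : List Bool → List Bool → ℝ
  | _pre, [] => 1
  | pre, b :: rest =>
      (match actn k T x pre with
        | some a => bitProbP k Ot a b
        | none => 0) *
        traceWeightPAux k Ot T x (pre ++ [b]) rest

/-- `lamP k Õ T x b` is the probability λ_T^{Õ}(b|x) that machine `T`, run with the
`k`-partial oracle `Õ` on input `x`, outputs the bit `b`. -/
noncomputable def lamP (k : ℕ) (Ot : PartialOracle k) (T : Machine) (x : List Bool)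
    (b : Bool) : ℝ :=
  ∑' s : { s : List Bool // actn k T x s = some (Action.output b) },
    traceWeightPAux k Ot T x [] s.1

/-- A `k`-partial oracle `Õ` approximates an oracle `O` iff
`|O(q_i) - Õ(q_i)| ≤ 2^(-k-1)` for all `i < k`. -/
def Approximates {k : ℕ} (Ot : PartialOracle k) (O : Query → ℝ) : Prop :=
  ∀ i : Fin k, |O (qEnum i) - (Ot.1 i : ℝ)| ≤ (2 : ℝ) ^ (-(k : ℤ) - 1)

/-- A `k`-partial oracle `Õ` is `k`-partially reflective iff for each of the first `k`
queries `(T,x,p)`: λ_T^{Õ}(1|x) > p implies `Õ(T,x,p) = 1`, and λ_T^{Õ}(0|x) > 1 - p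
implies `Õ(T,x,p) = 0`. -/
def PartiallyReflective {k : ℕ} (Ot : PartialOracle k) : Prop :=
  ∀ i : Fin k,
    (((qEnum i).2.2 : ℝ) < lamP k Ot (qEnum i).1 (qEnum i).2.1 true → Ot.1 i = 1) ∧
    (1 - ((qEnum i).2.2 : ℝ) < lamP k Ot (qEnum i).1 (qEnum i).2.1 false → Ot.1 i = 0)

/-- A `(k+1)`-partial oracle `Õ'` extends a `k`-partial oracle `Õ` iff
`|Õ(q_i) - Õ'(q_i)| ≤ 2^(-k-1)` for all `i < k`. -/
def Extends {k : ℕ} (Ot' : PartialOracle (k + 1)) (Ot : PartialOracle k) : Prop :=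
  ∀ i : Fin k, |Ot.1 i - Ot'.1 i.castSucc| ≤ (2 : ℚ) ^ (-(k : ℤ) - 1)

/-- The value that the sequence of partial oracles `(Õ_k)` assigns to the query `q`
at stage `k` (and `0` before `q` is in the domain). -/
noncomputable def seqVal (Ot : (k : ℕ) → PartialOracle k) (q : Query) (k : ℕ) : ℝ :=
  if h : Encodable.encode q < k then ((Ot k).1 ⟨Encodable.encode q, h⟩ : ℝ) else 0

end GrainOfTruth

namespace GrainOfTruth

open Filter Topology

/-- The weight of a path in the binary tree: the product of the weights `p` of its edges, where
the path `s` starts at the node `pre`. -/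
noncomputable def pathWeight (p : List Bool → Bool → ℝ) : List Bool → List Bool → ℝ
  | _, [] => 1
  | pre, b :: rest => p pre b * pathWeight p (pre ++ [b]) rest

/-- The bit strings of length at most `n`. -/
def listsUpTo : ℕ → Finset (List Bool)
  | 0 => {[]}
  | n + 1 => insert [] ((Finset.univ ×ˢ listsUpTo n).image fun bs => bs.1 :: bs.2)

theorem mem_listsUpTo {n : ℕ} {s : List Bool} : s ∈ listsUpTo n ↔ s.length ≤ n := by
  induction n generalizing s with
  | zero => simp [listsUpTo]
  | succ n ih => cases s <;> simp [listsUpTo, ih]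

theorem sum_listsUpTo_succ (n : ℕ) (f : List Bool → ℝ) :
    ∑ s ∈ listsUpTo (n + 1), f s = f [] + ∑ b, ∑ s ∈ listsUpTo n, f (b :: s) := by
  rw [listsUpTo, Finset.sum_insert (by simp), Finset.sum_image, Finset.sum_product]
  rintro ⟨a, s⟩ _ ⟨b, t⟩ _ h
  simpa using h

theorem pathWeight_nonneg {p : List Bool → Bool → ℝ} (hp : ∀ s b, 0 ≤ p s b)
    (pre s : List Bool) : 0 ≤ pathWeight p pre s := by
  induction s generalizing pre with
  | nil => simp [pathWeight]
  | cons b s ih => exact mul_nonneg (hp _ _) (ih _)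

theorem pathWeight_mono {p p' : List Bool → Bool → ℝ} (hp : ∀ s b, 0 ≤ p s b)
    (h : ∀ s b, p s b ≤ p' s b) (pre s : List Bool) :
    pathWeight p pre s ≤ pathWeight p' pre s := by
  induction s generalizing pre with
  | nil => simp [pathWeight]
  | cons b s ih =>
    exact mul_le_mul (h _ _) (ih _) (pathWeight_nonneg hp _ _) ((hp _ _).trans (h _ _))

theorem eventually_pathWeight_eq {p : ℕ → List Bool → Bool → ℝ} {p' : List Bool → Bool → ℝ}
    (h : ∀ s b, ∀ᶠ k in atTop, p k s b = p' s b) (pre s : List Bool) :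
    ∀ᶠ k in atTop, pathWeight (p k) pre s = pathWeight p' pre s := by
  induction s generalizing pre with
  | nil => simp [pathWeight]
  | cons b s ih =>
    filter_upwards [h pre b, ih (pre ++ [b])] with k h₁ h₂
    simp [pathWeight, h₁, h₂]

theorem sum_pathWeight_mul_deficit_le {p : List Bool → Bool → ℝ} (hp : ∀ s b, 0 ≤ p s b)
    (n : ℕ) (pre : List Bool) :
    ∑ s ∈ listsUpTo n, pathWeight p pre s * (1 - ∑ b, p (pre ++ s) b) ≤ 1 := by
  induction n generalizing pre with
  | zero =>
    have := Finset.sum_nonneg fun b (_ : b ∈ Finset.univ) => hp pre b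
    simpa [listsUpTo, pathWeight] using this
  | succ n ih =>
    rw [sum_listsUpTo_succ]
    have key : ∀ b, ∑ s ∈ listsUpTo n,
        pathWeight p pre (b :: s) * (1 - ∑ c, p (pre ++ b :: s) c) ≤ p pre b := by
      intro b
      have h := mul_le_mul_of_nonneg_left (ih (pre ++ [b])) (hp pre b)
      simpa [Finset.mul_sum, pathWeight, mul_assoc] using h
    have := Finset.sum_le_sum fun b (_ : b ∈ Finset.univ) => key b
    simp only [pathWeight, List.append_nil, one_mul] at this ⊢
    linarith

theorem summable_indicator_pathWeight {p : List Bool → Bool → ℝ} (hp : ∀ s b, 0 ≤ p s b)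
    (hp1 : ∀ s, ∑ b, p s b ≤ 1) {A : Set (List Bool)} (hA : ∀ s ∈ A, ∀ b, p s b = 0) :
    Summable (A.indicator (pathWeight p [])) := by
  refine summable_of_sum_le (c := 1)
    (fun s => Set.indicator_nonneg (fun _ _ => pathWeight_nonneg hp _ _) s) fun u => ?_
  have hle : ∀ s, A.indicator (pathWeight p []) s ≤
      pathWeight p [] s * (1 - ∑ b, p ([] ++ s) b) := by
    intro s
    by_cases hs : s ∈ A
    · simp [hs, hA s hs]
    · rw [Set.indicator_of_notMem hs]
      exact mul_nonneg (pathWeight_nonneg hp _ _) (sub_nonneg.2 (hp1 _))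
  have hsub : u ⊆ listsUpTo (u.sup List.length) := fun s hs =>
    mem_listsUpTo.2 (Finset.le_sup (f := List.length) hs)
  calc ∑ s ∈ u, A.indicator (pathWeight p []) s
      ≤ ∑ s ∈ u, pathWeight p [] s * (1 - ∑ b, p ([] ++ s) b) :=
        Finset.sum_le_sum fun s _ => hle s
    _ ≤ ∑ s ∈ listsUpTo (u.sup List.length), pathWeight p [] s * (1 - ∑ b, p ([] ++ s) b) :=
        Finset.sum_le_sum_of_subset_of_nonneg hsub fun s _ _ =>
          mul_nonneg (pathWeight_nonneg hp _ _) (sub_nonneg.2 (hp1 _))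
    _ ≤ 1 := sum_pathWeight_mul_deficit_le hp _ _

theorem sum_abs_pathWeight_le {p : List Bool → Bool → ℝ} (hp : ∀ s, ∑ b, |p s b| ≤ 1)
    (n : ℕ) (pre : List Bool) : ∑ s ∈ listsUpTo n, |pathWeight p pre s| ≤ n + 1 := by
  induction n generalizing pre with
  | zero => simp [listsUpTo, pathWeight]
  | succ n ih =>
    rw [sum_listsUpTo_succ]
    have key : ∀ b, ∑ s ∈ listsUpTo n, |pathWeight p pre (b :: s)| ≤ |p pre b| * (n + 1) := by
      intro b
      simpa [pathWeight, abs_mul, ← Finset.mul_sum] using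
        mul_le_mul_of_nonneg_left (ih (pre ++ [b])) (abs_nonneg (p pre b))
    have h := Finset.sum_le_sum fun b (_ : b ∈ Finset.univ) => key b
    rw [← Finset.sum_mul] at h
    have h' := mul_le_mul_of_nonneg_right (hp pre) (by positivity : (0 : ℝ) ≤ n + 1)
    simp only [pathWeight, abs_one] at h ⊢
    push_cast
    linarith

theorem sum_abs_pathWeight_sub_le {p p' : List Bool → Bool → ℝ} {ε : ℝ}
    (hp : ∀ s, ∑ b, |p s b| ≤ 1) (hp' : ∀ s, ∑ b, |p' s b| ≤ 1)
    (hε : ∀ s, ∑ b, |p s b - p' s b| ≤ ε) (n : ℕ) (pre : List Bool) :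
    ∑ s ∈ listsUpTo n, |pathWeight p pre s - pathWeight p' pre s| ≤ n * (n + 1) * ε := by
  have hε0 : 0 ≤ ε := (Finset.sum_nonneg fun b _ => abs_nonneg _).trans (hε [])
  induction n generalizing pre with
  | zero => simp [listsUpTo, pathWeight]
  | succ n ih =>
    rw [sum_listsUpTo_succ]
    have key : ∀ b, ∑ s ∈ listsUpTo n, |pathWeight p pre (b :: s) - pathWeight p' pre (b :: s)| ≤
        |p pre b| * (n * (n + 1) * ε) + |p pre b - p' pre b| * (n + 1) := by
      intro b
      have h₁ := mul_le_mul_of_nonneg_left (ih (pre ++ [b])) (abs_nonneg (p pre b))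
      have h₂ := mul_le_mul_of_nonneg_left (sum_abs_pathWeight_le hp' n (pre ++ [b]))
        (abs_nonneg (p pre b - p' pre b))
      refine le_trans ?_ (add_le_add h₁ h₂)
      rw [Finset.mul_sum, Finset.mul_sum, ← Finset.sum_add_distrib]
      refine Finset.sum_le_sum fun s _ => ?_
      rw [← abs_mul, ← abs_mul]
      refine le_trans (le_of_eq ?_) (abs_add_le _ _)
      simp only [pathWeight]
      ring_nf
    have h := Finset.sum_le_sum fun b (_ : b ∈ Finset.univ) => key b
    rw [Finset.sum_add_distrib, ← Finset.sum_mul, ← Finset.sum_mul] at h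
    have h₁ := mul_le_mul_of_nonneg_right (hp pre) (by positivity : (0 : ℝ) ≤ n * (n + 1) * ε)
    have h₂ := mul_le_mul_of_nonneg_right (hε pre) (by positivity : (0 : ℝ) ≤ n + 1)
    have h₃ : (0 : ℝ) ≤ (n + 1) * ε := by positivity
    simp only [pathWeight, sub_self, abs_zero] at h ⊢
    push_cast
    linarith

theorem ne_zero_of_pathWeight_ne_zero {p : List Bool → Bool → ℝ} {pre s : List Bool}
    (h : pathWeight p pre s ≠ 0) {i : ℕ} (hi : i < s.length) :
    ∃ b, p (pre ++ s.take i) b ≠ 0 := by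
  induction s generalizing pre i with
  | nil => simp at hi
  | cons b s ih =>
    rw [pathWeight, mul_ne_zero_iff] at h
    cases i with
    | zero => exact ⟨b, by simpa using h.1⟩
    | succ i => simpa using ih h.2 (by simpa using hi)

theorem act_of_actn {k : ℕ} {T : Machine} {x s : List Bool} {a : Action}
    (h : actn k T x s = some a) : act T x s = Part.some a := by
  obtain ⟨m, hm, rfl⟩ := Option.map_eq_some_iff.1 h
  have := Part.eq_some_iff.2 (Nat.Partrec.Code.evaln_sound hm)
  rw [act, this, Part.map_some]

theorem eventually_actn_of_act {T : Machine} {x s : List Bool} {a : Action}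
    (h : act T x s = Part.some a) : ∀ᶠ k in atTop, actn k T x s = some a := by
  obtain ⟨m, hm, rfl⟩ := (Part.mem_map_iff _).1 (Part.eq_some_iff.1 h)
  obtain ⟨k₀, hk₀⟩ := Nat.Partrec.Code.evaln_complete.1 hm
  filter_upwards [eventually_ge_atTop k₀] with k hk
  exact Option.map_eq_some_iff.2 ⟨m, Nat.Partrec.Code.evaln_mono hk hk₀, rfl⟩

theorem encode_lt_of_actn {k : ℕ} {T : Machine} {x s : List Bool} {a : Action}
    (h : actn k T x s = some a) : Encodable.encode s < k := by
  obtain ⟨m, hm, -⟩ := Option.map_eq_some_iff.1 h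
  exact (Nat.right_le_pair _ _).trans_lt (Nat.Partrec.Code.evaln_bound hm)

/-- The probability that `T` with oracle `O` on input `x` next receives the bit `b`, after having
received the bits `s`. -/
noncomputable def stepProb (T : Machine) (O : Query → ℝ) (x s : List Bool) (b : Bool) : ℝ :=
  open scoped Classical in
  if h : (act T x s).Dom then bitProb O ((act T x s).get h) b else 0

theorem stepProb_of_act {T : Machine} {O : Query → ℝ} {x s : List Bool} {a : Action}
    (h : act T x s = Part.some a) (b : Bool) : stepProb T O x s b = bitProb O a b := by
  simp [stepProb, h]

/-- The next-bit probabilities of the run of `T` on input `x` whose number of steps is at most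
`k` in every configuration and whose action `a` yields the bit `b` with probability `w a b`. -/
noncomputable def boundedStepProb (k : ℕ) (w : Action → Bool → ℝ) (T : Machine)
    (x s : List Bool) (b : Bool) : ℝ :=
  (actn k T x s).elim 0 fun a => w a b

/-- The next-bit probabilities with oracle `O`, where queries of index `≥ k` halt the run. -/
noncomputable def truncBitProb (k : ℕ) (O : Query → ℝ) : Action → Bool → ℝ
  | .output _, _ => 0
  | .flip, _ => 1 / 2
  | .ask q, b => if Encodable.encode q < k then bitProb O (.ask q) b else 0

theorem traceWeightAux_eq_pathWeight (T : Machine) (O : Query → ℝ) (x pre s : List Bool) :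
    traceWeightAux T O x pre s = pathWeight (stepProb T O x) pre s := by
  induction s generalizing pre with
  | nil => rfl
  | cons b s ih => rw [traceWeightAux, pathWeight, ih]; rfl

theorem traceWeightPAux_eq_pathWeight (k : ℕ) (Ot : PartialOracle k) (T : Machine)
    (x pre s : List Bool) :
    traceWeightPAux k Ot T x pre s =
      pathWeight (boundedStepProb k (bitProbP k Ot) T x) pre s := by
  induction s generalizing pre with
  | nil => rfl
  | cons b s ih =>
    rw [traceWeightPAux, pathWeight, ih, boundedStepProb]
    cases actn k T x pre <;> rfl

theorem pathWeight_boundedStepProb_eq_zero {k : ℕ} {w : Action → Bool → ℝ} {T : Machine}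
    {x s : List Bool} (hs : s ∉ listsUpTo k) : pathWeight (boundedStepProb k w T x) [] s = 0 := by
  by_contra h
  rw [mem_listsUpTo, not_le] at hs
  have hlt : ∀ i : Fin s.length, Encodable.encode (s.take i) < k := by
    intro i
    obtain ⟨b, hb⟩ := ne_zero_of_pathWeight_ne_zero h i.2
    cases ha : actn k T x (s.take i) with
    | none => simp [boundedStepProb, ha] at hb
    | some a => exact encode_lt_of_actn ha
  have hinj : Function.Injective
      fun i : Fin s.length => (⟨Encodable.encode (s.take i), hlt i⟩ : Fin k) := by
    intro i j hij
    have h₁ : s.take i = s.take j := Encodable.encode_injective (Fin.mk.inj_iff.1 hij)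
    have h₂ := congrArg List.length h₁
    simp only [List.length_take] at h₂
    exact Fin.ext (by omega)
  have := Fintype.card_le_of_injective _ hinj
  simp only [Fintype.card_fin] at this
  omega

theorem sum_abs_boundedStepProb_sub_le {k : ℕ} {w w' : Action → Bool → ℝ} {ε : ℝ} (hε : 0 ≤ ε)
    (h : ∀ a, ∑ b, |w a b - w' a b| ≤ ε) (T : Machine) (x s : List Bool) :
    ∑ b, |boundedStepProb k w T x s b - boundedStepProb k w' T x s b| ≤ ε := by
  simp only [boundedStepProb]
  cases actn k T x s with
  | none => simpa using hε
  | some a => exact h a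

theorem sum_abs_boundedStepProb_le {k : ℕ} {w : Action → Bool → ℝ}
    (h : ∀ a, ∑ b, |w a b| ≤ 1) (T : Machine) (x s : List Bool) :
    ∑ b, |boundedStepProb k w T x s b| ≤ 1 := by
  simp only [boundedStepProb]
  cases actn k T x s with
  | none => simp
  | some a => exact h a

theorem bitProb_nonneg {O : Query → ℝ} (hO : IsOracle O) (a : Action) (b : Bool) :
    0 ≤ bitProb O a b := by
  cases a with
  | output => simp [bitProb]
  | flip => simp [bitProb]
  | ask q => cases b <;> simp [bitProb, (hO q).1, (hO q).2]

theorem sum_bitProb_le {O : Query → ℝ} (a : Action) : ∑ b, bitProb O a b ≤ 1 := by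
  cases a <;> norm_num [bitProb]

theorem truncBitProb_nonneg {O : Query → ℝ} (hO : IsOracle O) (k : ℕ) (a : Action) (b : Bool) :
    0 ≤ truncBitProb k O a b := by
  cases a with
  | output => simp [truncBitProb]
  | flip => simp [truncBitProb]
  | ask q =>
    rw [truncBitProb]
    split_ifs
    exacts [bitProb_nonneg hO _ _, le_rfl]

theorem truncBitProb_le {O : Query → ℝ} (hO : IsOracle O) (k : ℕ) (a : Action) (b : Bool) :
    truncBitProb k O a b ≤ bitProb O a b := by
  cases a with
  | output => simp [truncBitProb, bitProb]
  | flip => simp [truncBitProb, bitProb]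
  | ask q =>
    rw [truncBitProb]
    split_ifs
    exacts [le_rfl, bitProb_nonneg hO _ _]

theorem eventually_truncBitProb_eq (O : Query → ℝ) (a : Action) (b : Bool) :
    ∀ᶠ k in atTop, truncBitProb k O a b = bitProb O a b := by
  cases a with
  | output => simp [truncBitProb, bitProb]
  | flip => simp [truncBitProb, bitProb]
  | ask q =>
    filter_upwards [eventually_gt_atTop (Encodable.encode q)] with k hk
    simp [truncBitProb, hk]

theorem sum_abs_truncBitProb_le {O : Query → ℝ} (hO : IsOracle O) (k : ℕ) (a : Action) :
    ∑ b, |truncBitProb k O a b| ≤ 1 :=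
  (Finset.sum_le_sum fun b _ => by
    rw [abs_of_nonneg (truncBitProb_nonneg hO k a b)]
    exact truncBitProb_le hO k a b).trans (sum_bitProb_le a)

theorem stepProb_nonneg {O : Query → ℝ} (hO : IsOracle O) (T : Machine) (x s : List Bool)
    (b : Bool) : 0 ≤ stepProb T O x s b := by
  rw [stepProb]
  split_ifs
  exacts [bitProb_nonneg hO _ _, le_rfl]

theorem sum_stepProb_le (T : Machine) (O : Query → ℝ) (x s : List Bool) :
    ∑ b, stepProb T O x s b ≤ 1 := by
  by_cases h : (act T x s).Dom
  · simpa only [stepProb, h, dite_true] using sum_bitProb_le _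
  · simp [stepProb, h]

theorem boundedStepProb_truncBitProb_nonneg {O : Query → ℝ} (hO : IsOracle O) (k : ℕ)
    (T : Machine) (x s : List Bool) (b : Bool) :
    0 ≤ boundedStepProb k (truncBitProb k O) T x s b := by
  rw [boundedStepProb]
  cases actn k T x s
  exacts [le_rfl, truncBitProb_nonneg hO _ _ _]

theorem boundedStepProb_truncBitProb_le {O : Query → ℝ} (hO : IsOracle O) (k : ℕ)
    (T : Machine) (x s : List Bool) (b : Bool) :
    boundedStepProb k (truncBitProb k O) T x s b ≤ stepProb T O x s b := by
  rw [boundedStepProb]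
  cases h : actn k T x s with
  | none => exact stepProb_nonneg hO _ _ _ _
  | some a =>
    rw [stepProb_of_act (act_of_actn h)]
    exact truncBitProb_le hO _ _ _

theorem eventually_boundedStepProb_truncBitProb_eq (O : Query → ℝ) (T : Machine)
    (x s : List Bool) (b : Bool) :
    ∀ᶠ k in atTop, boundedStepProb k (truncBitProb k O) T x s b = stepProb T O x s b := by
  by_cases h : (act T x s).Dom
  · obtain ⟨a, ha⟩ : ∃ a, act T x s = Part.some a := ⟨_, (Part.some_get h).symm⟩
    filter_upwards [eventually_actn_of_act ha, eventually_truncBitProb_eq O a b] with k h₁ h₂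
    rw [stepProb_of_act ha, boundedStepProb, h₁, ← h₂, Option.elim_some]
  · refine Eventually.of_forall fun k => ?_
    cases ha : actn k T x s with
    | none => simp [boundedStepProb, ha, stepProb, h]
    | some a => exact absurd (by simp [act_of_actn ha]) h

theorem PartialOracle.eq_zero_or_eq_one_or_mem {k : ℕ} (Ot : PartialOracle k) (i : Fin k) :
    (Ot.1 i : ℝ) = 0 ∨ (Ot.1 i : ℝ) = 1 ∨
      ((2 : ℝ) ^ (-(k : ℤ)) ≤ Ot.1 i ∧ (Ot.1 i : ℝ) ≤ 1 - 2 ^ (-(k : ℤ))) := by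
  obtain ⟨n, hn, h⟩ := Ot.2 i
  have hk : (0 : ℝ) < 2 ^ k := by positivity
  rw [h, zpow_neg, zpow_natCast, ← one_div]
  push_cast
  rcases Nat.eq_zero_or_pos n with rfl | h0
  · simp
  rcases hn.eq_or_lt with rfl | h1
  · right; left; push_cast; field_simp
  · right; right
    have h0' : (1 : ℝ) ≤ n := by exact_mod_cast h0
    have h1' : (n : ℝ) + 1 ≤ 2 ^ k := by exact_mod_cast h1
    constructor
    · gcongr
    · rw [le_sub_iff_add_le, ← add_div, div_le_one hk]
      exact h1'

theorem PartialOracle.nonneg_and_le_one {k : ℕ} (Ot : PartialOracle k) (i : Fin k) :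
    0 ≤ (Ot.1 i : ℝ) ∧ (Ot.1 i : ℝ) ≤ 1 := by
  have h2 : (0 : ℝ) < 2 ^ (-(k : ℤ)) := by positivity
  rcases Ot.eq_zero_or_eq_one_or_mem i with h | h | h
  · simp [h]
  · simp [h]
  · constructor <;> linarith

/-- Subtracting the rounding error may make a bit probability negative, but the absolute values
still form a sub-probability. -/
theorem sum_abs_bitProbP_le {k : ℕ} (Ot : PartialOracle k) (a : Action) :
    ∑ b, |bitProbP k Ot a b| ≤ 1 := by
  cases a with
  | output => simp [bitProbP]
  | flip => norm_num [bitProbP]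
  | ask q =>
    by_cases h : Encodable.encode q < k
    · have h2 : (0 : ℝ) < 2 ^ (-(k : ℤ) - 1) := by positivity
      have h3 : (2 : ℝ) ^ (-(k : ℤ)) = 2 * 2 ^ (-(k : ℤ) - 1) := by
        rw [← zpow_one_add₀ two_ne_zero]; ring_nf
      have h4 : (2 : ℝ) ^ (-(k : ℤ)) ≤ 1 := zpow_le_one_of_nonpos₀ one_le_two (by simp)
      simp only [Fintype.sum_bool, bitProbP, h, dite_true, if_true, Bool.false_eq_true, if_false]
      rcases Ot.eq_zero_or_eq_one_or_mem ⟨_, h⟩ with h' | h' | h'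
      · rw [h', abs_of_nonpos (by linarith), abs_of_nonneg (by linarith)]; linarith
      · rw [h', abs_of_nonneg (by linarith), abs_of_nonpos (by linarith)]; linarith
      · rw [abs_of_nonneg (by linarith), abs_of_nonneg (by linarith)]; linarith
    · simp [bitProbP, h]

theorem abs_seqVal_sub_le {Ot : (k : ℕ) → PartialOracle k}
    (hext : ∀ k, Extends (Ot (k + 1)) (Ot k)) {q : Query} {k : ℕ}
    (hk : Encodable.encode q < k) (n : ℕ) :
    |seqVal Ot q k - seqVal Ot q (k + n)| ≤ (2 : ℝ)⁻¹ ^ k - 2⁻¹ ^ (k + n) := by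
  induction n with
  | zero => simp
  | succ n ih =>
    have hn : Encodable.encode q < k + n := by omega
    have hstep : |seqVal Ot q (k + n) - seqVal Ot q (k + n + 1)| ≤ (2 : ℝ)⁻¹ ^ (k + n + 1) := by
      have h : (|(Ot (k + n)).1 ⟨_, hn⟩ - (Ot (k + n + 1)).1 (Fin.castSucc ⟨_, hn⟩)| : ℝ) ≤
          (2 : ℝ) ^ (-((k + n : ℕ) : ℤ) - 1) := by
        have := (Rat.cast_le (K := ℝ)).2 (hext (k + n) ⟨_, hn⟩)
        push_cast at this ⊢
        exact this
      rw [seqVal, seqVal, dif_pos hn, dif_pos (hn.trans (Nat.lt_succ_self _))]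
      refine h.trans (le_of_eq ?_)
      rw [inv_pow, ← zpow_natCast, ← zpow_neg]
      congr 1
      push_cast
      ring
    have := abs_sub_le (seqVal Ot q k) (seqVal Ot q (k + n)) (seqVal Ot q (k + n + 1))
    rw [pow_succ] at hstep
    rw [← add_assoc, pow_succ]
    linarith

theorem abs_seqVal_sub_limit_le {Ot : (k : ℕ) → PartialOracle k}
    (hext : ∀ k, Extends (Ot (k + 1)) (Ot k)) {q : Query} {c : ℝ}
    (hlim : Tendsto (seqVal Ot q) atTop (𝓝 c)) {k : ℕ} (hk : Encodable.encode q < k) :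
    |seqVal Ot q k - c| ≤ (2 : ℝ)⁻¹ ^ k := by
  have h : Tendsto (fun n => |seqVal Ot q k - seqVal Ot q (n + k)|) atTop
      (𝓝 |seqVal Ot q k - c|) :=
    (((tendsto_add_atTop_iff_nat k).2 hlim).const_sub _).abs
  refine le_of_tendsto h (Eventually.of_forall fun n => ?_)
  have := abs_seqVal_sub_le hext hk n
  rw [add_comm n k]
  exact this.trans (sub_le_self _ (by positivity))

theorem isOracle_of_tendsto_seqVal {Ot : (k : ℕ) → PartialOracle k} {O : Query → ℝ}
    (hlim : ∀ q, Tendsto (seqVal Ot q) atTop (𝓝 (O q))) : IsOracle O := by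
  have hmem : ∀ q k, 0 ≤ seqVal Ot q k ∧ seqVal Ot q k ≤ 1 := by
    intro q k
    rw [seqVal]
    split_ifs
    exacts [(Ot k).nonneg_and_le_one _, ⟨le_rfl, zero_le_one⟩]
  exact fun q => ⟨ge_of_tendsto' (hlim q) fun k => (hmem q k).1,
    le_of_tendsto' (hlim q) fun k => (hmem q k).2⟩

theorem sum_abs_bitProbP_sub_truncBitProb_le {Ot : (k : ℕ) → PartialOracle k}
    (hext : ∀ k, Extends (Ot (k + 1)) (Ot k)) {O : Query → ℝ}
    (hlim : ∀ q, Tendsto (seqVal Ot q) atTop (𝓝 (O q))) (k : ℕ) (a : Action) :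
    ∑ b, |bitProbP k (Ot k) a b - truncBitProb k O a b| ≤ 3 * (2 : ℝ)⁻¹ ^ k := by
  cases a with
  | output => simp [bitProbP, truncBitProb]
  | flip => simp [bitProbP, truncBitProb]
  | ask q =>
    by_cases h : Encodable.encode q < k
    · have h₁ := abs_le.1 (abs_seqVal_sub_limit_le hext (hlim q) h)
      have h₂ : (2 : ℝ) ^ (-(k : ℤ) - 1) = 2⁻¹ ^ k / 2 := by
        rw [zpow_sub₀ two_ne_zero, zpow_neg, zpow_natCast, inv_pow, zpow_one]
      have h₃ : (0 : ℝ) < 2⁻¹ ^ k := by positivity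
      rw [seqVal, dif_pos h] at h₁
      simp only [Fintype.sum_bool, bitProbP, truncBitProb, bitProb, h, dite_true, if_true,
        Bool.false_eq_true, if_false, h₂]
      have h₄ : ∀ u v r : ℝ, |u| ≤ r → |v| ≤ r → |u| + |v| ≤ 2 * r := by
        intro u v r hu hv; linarith
      refine (h₄ _ _ (3 / 2 * 2⁻¹ ^ k) (abs_le.2 ?_) (abs_le.2 ?_)).trans (by linarith)
      · constructor <;> linarith
      · constructor <;> linarith
    · simp [bitProbP, truncBitProb, h]

/-- The traces after which `T` outputs `b` on input `x` within `k` steps. -/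
def boundedOutputTraces (k : ℕ) (T : Machine) (x : List Bool) (b : Bool) : Set (List Bool) :=
  {s | actn k T x s = some (Action.output b)}

/-- The traces after which `T` outputs `b` on input `x`. -/
def outputTraces (T : Machine) (x : List Bool) (b : Bool) : Set (List Bool) :=
  {s | act T x s = Part.some (Action.output b)}

theorem lam_eq_tsum_indicator (T : Machine) (O : Query → ℝ) (x : List Bool) (b : Bool) :
    lam T O x b = ∑' s, (outputTraces T x b).indicator (pathWeight (stepProb T O x) []) s := by
  rw [← tsum_subtype]
  exact tsum_congr fun s => traceWeightAux_eq_pathWeight _ _ _ _ _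

theorem lamP_eq_tsum_indicator (k : ℕ) (Ot : PartialOracle k) (T : Machine) (x : List Bool)
    (b : Bool) :
    lamP k Ot T x b = ∑' s, (boundedOutputTraces k T x b).indicator
      (pathWeight (boundedStepProb k (bitProbP k Ot) T x) []) s := by
  rw [← tsum_subtype]
  exact tsum_congr fun s => traceWeightPAux_eq_pathWeight _ _ _ _ _ _

theorem tsum_indicator_boundedStepProb (k : ℕ) (w : Action → Bool → ℝ) (T : Machine)
    (x : List Bool) (A : Set (List Bool)) :
    ∑' s, A.indicator (pathWeight (boundedStepProb k w T x) []) s =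
      ∑ s ∈ listsUpTo k, A.indicator (pathWeight (boundedStepProb k w T x) []) s :=
  tsum_eq_sum fun s hs => by
    rw [Set.indicator_apply_eq_zero]
    exact fun _ => pathWeight_boundedStepProb_eq_zero hs

theorem abs_tsum_indicator_boundedStepProb_sub_le {k : ℕ} {w w' : Action → Bool → ℝ} {ε : ℝ}
    (hε : 0 ≤ ε) (hw : ∀ a, ∑ b, |w a b| ≤ 1) (hw' : ∀ a, ∑ b, |w' a b| ≤ 1)
    (h : ∀ a, ∑ b, |w a b - w' a b| ≤ ε) (T : Machine) (x : List Bool) (A : Set (List Bool)) :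
    |∑' s, A.indicator (pathWeight (boundedStepProb k w T x) []) s -
      ∑' s, A.indicator (pathWeight (boundedStepProb k w' T x) []) s| ≤ k * (k + 1) * ε := by
  rw [tsum_indicator_boundedStepProb, tsum_indicator_boundedStepProb, ← Finset.sum_sub_distrib]
  refine (Finset.abs_sum_le_sum_abs _ _).trans ((Finset.sum_le_sum fun s _ => ?_).trans
    (sum_abs_pathWeight_sub_le (sum_abs_boundedStepProb_le hw T x)
      (sum_abs_boundedStepProb_le hw' T x) (sum_abs_boundedStepProb_sub_le (k := k) hε h T x) k []))
  by_cases hs : s ∈ A <;> simp [hs]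

theorem tendsto_tsum_indicator_truncBitProb {O : Query → ℝ} (hO : IsOracle O) (T : Machine)
    (x : List Bool) (b : Bool) :
    Tendsto (fun k => ∑' s, (boundedOutputTraces k T x b).indicator
      (pathWeight (boundedStepProb k (truncBitProb k O) T x) []) s) atTop (𝓝 (lam T O x b)) := by
  rw [lam_eq_tsum_indicator]
  have hnn := fun k => pathWeight_nonneg (boundedStepProb_truncBitProb_nonneg hO k T x) []
  refine tendsto_tsum_of_dominated_convergence
    (bound := (outputTraces T x b).indicator (pathWeight (stepProb T O x) []))
    (summable_indicator_pathWeight (stepProb_nonneg hO T x) (sum_stepProb_le T O x)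
      fun s hs c => by rw [stepProb_of_act hs, bitProb]) (fun s => ?_)
    (Eventually.of_forall fun k s => ?_)
  · refine tendsto_const_nhds.congr' ?_
    by_cases hs : s ∈ outputTraces T x b
    · filter_upwards [eventually_actn_of_act hs, eventually_pathWeight_eq
        (eventually_boundedStepProb_truncBitProb_eq O T x) [] s] with k h₁ h₂
      rw [Set.indicator_of_mem hs, Set.indicator_of_mem (show s ∈ boundedOutputTraces k T x b
        from h₁), h₂]
    · refine Eventually.of_forall fun k => ?_
      have hk : s ∉ boundedOutputTraces k T x b := fun h => hs (act_of_actn h)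
      simp only [Set.indicator_of_notMem hs, Set.indicator_of_notMem hk]
  · rw [Real.norm_of_nonneg (Set.indicator_nonneg (fun s _ => hnn k s) s)]
    by_cases hs : s ∈ boundedOutputTraces k T x b
    · rw [Set.indicator_of_mem hs, Set.indicator_of_mem (show s ∈ outputTraces T x b
        from act_of_actn hs)]
      exact pathWeight_mono (boundedStepProb_truncBitProb_nonneg hO k T x)
        (boundedStepProb_truncBitProb_le hO k T x) _ _
    · rw [Set.indicator_of_notMem hs]
      exact Set.indicator_nonneg (fun s _ => pathWeight_nonneg (stepProb_nonneg hO T x) [] s) s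

theorem tendsto_mul_succ_mul_inv_two_pow :
    Tendsto (fun k : ℕ => (k : ℝ) * (k + 1) * (3 * 2⁻¹ ^ k)) atTop (𝓝 0) := by
  have h₁ := tendsto_pow_const_mul_const_pow_of_lt_one 1 (r := (2 : ℝ)⁻¹)
    (by norm_num) (by norm_num)
  have h₂ := tendsto_pow_const_mul_const_pow_of_lt_one 2 (r := (2 : ℝ)⁻¹)
    (by norm_num) (by norm_num)
  have h := (h₁.add h₂).const_mul 3
  rw [add_zero, mul_zero] at h
  exact h.congr fun k => by ring

end GrainOfTruth

open GrainOfTruth in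
/-- Let `(Õ_k)` be a sequence where `Õ_k` is a `k`-partially reflective `k`-partial
oracle and `Õ_{k+1}` extends `Õ_k`, and let `O` be its pointwise limit.  Then
λ_T^{Õ_k}(1|x) → λ_T^O(1|x) and λ_T^{Õ_k}(0|x) → λ_T^O(0|x) as `k → ∞`,
for all `x` and `T`. -/
theorem lamP_tendsto_lam_of_pointwise_limit (Ot : (k : ℕ) → PartialOracle k)
    (hrefl : ∀ k, PartiallyReflective (Ot k))
    (hext : ∀ k, Extends (Ot (k + 1)) (Ot k))
    (O : Query → ℝ)
    (hlim : ∀ q : Query, Filter.Tendsto (seqVal Ot q) Filter.atTop (nhds (O q))) :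
    ∀ (x : List Bool) (T : Machine) (b : Bool),
      Filter.Tendsto (fun k => lamP k (Ot k) T x b) Filter.atTop
        (nhds (lam T O x b)) := by
  intro x T b
  have hO := isOracle_of_tendsto_seqVal hlim
  have hdiff : Filter.Tendsto (fun k => lamP k (Ot k) T x b -
      ∑' s, (boundedOutputTraces k T x b).indicator
        (pathWeight (boundedStepProb k (truncBitProb k O) T x) []) s)
      Filter.atTop (nhds 0) := by
    refine squeeze_zero_norm (fun k => ?_) tendsto_mul_succ_mul_inv_two_pow
    rw [Real.norm_eq_abs, lamP_eq_tsum_indicator]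
    exact abs_tsum_indicator_boundedStepProb_sub_le (by positivity) (sum_abs_bitProbP_le (Ot k))
      (sum_abs_truncBitProb_le hO k) (sum_abs_bitProbP_sub_truncBitProb_le hext hlim k) T x _
  simpa using hdiff.add (tendsto_tsum_indicator_truncBitProb hO T x b)
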